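/- G(x) > 0 for every real x > 0. -/

import Mathlib

open Filter Real

/-- `Q j = ∏_{ℓ=1}^{j} (1 - 2^{-ℓ})`. -/
noncomputable def Q (j : ℕ) : ℝ := ∏ l ∈ Finset.range j, (1 - (2:ℝ)^(-(l:ℤ)-1))

/-- `Q_∞ = ∏_{ℓ≥1} (1 - 2^{-ℓ})`. -/
noncomputable def Qinf : ℝ := ∏' l : ℕ, (1 - (2:ℝ)^(-(l:ℤ)-1))

/-- `φ(u,v;x) = e^{-ux} ∫_0^x t e^{(u-v)t} dt`. -/
noncomputable def phi (u v x : ℝ) : ℝ :=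
  Real.exp (-u * x) * ∫ t in (0:ℝ)..x, t * Real.exp ((u - v) * t)

/-- The function `G` describing the asymptotic variance of the external profile. -/
noncomputable def G (x : ℝ) : ℝ :=
  ∑' j : ℕ, ∑' r : ℕ, ∑ h ∈ Finset.range (j+1), ∑ l ∈ Finset.range (j+1),
    (-1:ℝ)^(r+h+l) *
      (2:ℝ)^(-(j:ℤ) - (r.choose 2 : ℤ) - (h.choose 2 : ℤ) - (l.choose 2 : ℤ)
        + 2*(h:ℤ) + 2*(l:ℤ)) *
      phi ((2:ℝ)^(r+j)) ((2:ℝ)^h + (2:ℝ)^l) x /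
      (Qinf * Q r * Q h * Q (j-h) * Q l * Q (j-l))

lemma Q_succ (n : ℕ) : Q (n+1) = Q n * (1 - (1/2:ℝ)^(n+1)) := by
  unfold Q
  rw [Finset.prod_range_succ]
  congr 2
  rw [one_div, inv_pow, ← zpow_natCast, ← zpow_neg]
  congr 1
  push_cast
  ring

lemma Q_zero : Q 0 = 1 := by simp [Q]

lemma half_pow_lt (n : ℕ) : (1/2:ℝ)^(n+1) < 1 := pow_lt_one₀ (by norm_num) (by norm_num) (by simp)

lemma Q_bound (n : ℕ) : 1/4 + (1/2:ℝ)^(n+2) ≤ Q (n+1) := by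
  induction n with
  | zero => rw [Q_succ, Q_zero]; norm_num
  | succ n ih =>
    rw [Q_succ]
    have h1 := half_pow_lt (n+1)
    have h2 : 0 < (1/2:ℝ)^n := by positivity
    have h3 : (1/2:ℝ)^n ≤ 1 := pow_le_one₀ (by norm_num) (by norm_num)
    have : (1/4 + (1/2:ℝ)^(n+2)) * (1 - (1/2:ℝ)^(n+1+1)) ≤ Q (n+1) * (1 - (1/2:ℝ)^(n+1+1)) :=
      mul_le_mul_of_nonneg_right ih (by linarith)
    refine le_trans ?_ this
    have e1 : (1/2:ℝ)^(n+1+1) = (1/2:ℝ)^n / 4 := by ring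
    have e2 : (1/2:ℝ)^(n+2) = (1/2:ℝ)^n / 4 := by ring
    have e3 : (1/2:ℝ)^(n+1+2) = (1/2:ℝ)^n / 8 := by ring
    rw [e1, e3]
    nlinarith

lemma Q_ge (n : ℕ) : 1/4 ≤ Q n := by
  cases n with
  | zero => rw [Q_zero]; norm_num
  | succ n => exact le_trans (by simp) (Q_bound n)

lemma Q_pos (n : ℕ) : 0 < Q n := lt_of_lt_of_le (by norm_num) (Q_ge n)
lemma Q_ne (n : ℕ) : Q n ≠ 0 := (Q_pos n).ne'

lemma Q_tendsto : Tendsto Q atTop (nhds Qinf) := by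
  have hm : Multipliable (fun l : ℕ => (1 + (-(2:ℝ)^(-(l:ℤ)-1)))) := by
    apply multipliable_one_add_of_summable
    have : Summable (fun l : ℕ => (1/2:ℝ)^l * (1/2)) :=
      (summable_geometric_of_lt_one (by norm_num) (by norm_num)).mul_right _
    refine this.congr (fun l => ?_)
    rw [norm_neg, Real.norm_of_nonneg (by positivity), zpow_sub₀ (by norm_num), zpow_neg]
    simp
    ring
  have hm' : Multipliable (fun l : ℕ => (1 - (2:ℝ)^(-(l:ℤ)-1))) := by
    simpa [sub_eq_add_neg] using hm
  exact hm'.hasProd.tendsto_prod_nat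

lemma Qinf_ge : 1/4 ≤ Qinf := ge_of_tendsto' Q_tendsto Q_ge
lemma Qinf_pos : 0 < Qinf := lt_of_lt_of_le (by norm_num) Qinf_ge

noncomputable def aa (r : ℕ) : ℝ := (-1)^r * (1/2:ℝ)^(r.choose 2) / Q r

lemma wbound (r : ℕ) : (1/2:ℝ)^(r.choose 2) * 4^r ≤ 64 * (1/2)^r := by
  have h : 3*r ≤ 6 + r.choose 2 := by
    have : 2 * r.choose 2 + r = r * r := by
      induction r with
      | zero => simp
      | succ n ih => rw [Nat.choose_succ_succ' n 1, Nat.choose_one_right]; nlinarith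
    by_cases h : r < 4
    · interval_cases r <;> simp [Nat.choose]
    · nlinarith
  have h2 : (2:ℝ)^(3*r) ≤ 2^(6 + r.choose 2) := pow_le_pow_right₀ (by norm_num) h
  rw [one_div, inv_pow, inv_pow, inv_mul_le_iff₀ (by positivity), ← div_eq_mul_inv, mul_div_assoc',
    le_div_iff₀ (by positivity)]
  calc (4:ℝ)^r * 2^r = 2^(3*r) := by rw [← mul_pow, pow_mul]; norm_num
    _ ≤ _ := h2
    _ = _ := by rw [pow_add]; norm_num; ring

lemma abs_aa4 (r : ℕ) : |aa r| * 4^r ≤ 256 * (1/2)^r := by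
  unfold aa
  rw [abs_div, abs_mul, abs_pow, abs_neg, abs_one, one_pow, one_mul, abs_of_pos (Q_pos r),
    abs_of_pos (by positivity), div_mul_eq_mul_div, div_le_iff₀ (Q_pos r)]
  have := wbound r
  have h2 : 0 < (1/2:ℝ)^r := by positivity
  nlinarith [Q_ge r]

lemma abs_aa2 (r : ℕ) : |aa r| * 2^r ≤ 256 * (1/2)^r :=
  le_trans (mul_le_mul_of_nonneg_left (pow_le_pow_left₀ (by norm_num) (by norm_num) r) (abs_nonneg _)) (abs_aa4 r)

lemma abs_aa (r : ℕ) : |aa r| ≤ 256 * (1/2)^r :=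
  le_trans (le_mul_of_one_le_right (abs_nonneg _) (one_le_pow₀ (by norm_num))) (abs_aa4 r)

lemma sgeo (c : ℝ) : Summable (fun r : ℕ => c * (1/2:ℝ)^r) :=
  (summable_geometric_of_lt_one (by norm_num) (by norm_num)).mul_left _

lemma aa_zero : aa 0 = 1 := by simp [aa, Q_zero]

lemma aa_succ (r : ℕ) : aa (r+1) * (1 - (1/2)^(r+1)) = - aa r * (1/2)^r := by
  unfold aa
  have := half_pow_lt r
  have h3 : (1 - (1/2:ℝ)^(r+1)) ≠ 0 := by linarith
  rw [Q_succ, Nat.choose_succ_succ' r 1, Nat.choose_one_right, pow_add (1/2:ℝ) r]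
  have := Q_ne r
  field_simp
  ring

lemma aa_succ' (r : ℕ) : aa (r+1) * (1 - 2^(r+1)) = 2 * aa r := by
  have h := aa_succ r
  have e : (1/2:ℝ)^r * 2^r = 1 := by rw [← mul_pow]; norm_num
  have e1 : (1/2:ℝ)^(r+1) * 2^(r+1) = 1 := by rw [← mul_pow]; norm_num
  have h4 : aa (r+1) * (1 - (1/2)^(r+1)) * 2^(r+1) = - aa r * (1/2)^r * 2^(r+1) := by rw [h]
  have h5 : - aa r * (1/2)^r * 2^(r+1) = -2 * aa r := by
    rw [pow_succ]; linear_combination (-2 * aa r) * e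
  linear_combination -h4 - h5 + (-aa (r+1)) * e1

noncomputable def Kn (n : ℕ) (s : ℝ) : ℝ :=
  ∑ r ∈ Finset.range (n+1), aa r / Q (n-r) * Real.exp (-2^r * s)

noncomputable def K (s : ℝ) : ℝ := ∑' r : ℕ, aa r / Qinf * Real.exp (-2^r * s)

lemma Kn_zero (n : ℕ) : Kn (n+1) 0 = 0 := by
  have hp := half_pow_lt n
  have key : (1 - (1/2:ℝ)^(n+1)) * Kn (n+1) 0 = 0 := by
    unfold Kn
    simp only [mul_zero, Real.exp_zero, mul_one]
    rw [Finset.mul_sum]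
    have e : ∀ r ∈ Finset.range (n+1+1), (1 - (1/2:ℝ)^(n+1)) * (aa r / Q (n+1-r)) =
        (1 - (1/2)^r) * aa r / Q (n+1-r) + (1/2)^r * aa r * ((1 - (1/2)^(n+1-r)) / Q (n+1-r)) := by
      intro r hr
      have hr' : r ≤ n+1 := by simp at hr; omega
      have : (1/2:ℝ)^(n+1) = (1/2)^r * (1/2)^(n+1-r) := by
        rw [← pow_add]; congr 1; omega
      rw [this]; ring
    rw [Finset.sum_congr rfl e, Finset.sum_add_distrib, Finset.sum_range_succ', 
      Finset.sum_range_succ (n := n+1)]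
    simp only [pow_zero, sub_self (1:ℝ), Nat.sub_self, zero_mul, zero_div, mul_zero, add_zero]
    rw [← Finset.sum_add_distrib]
    apply Finset.sum_eq_zero
    intro r hr
    have hr' : r ≤ n := by simp at hr; omega
    have e1 : n + 1 - (r+1) = n - r := by omega
    have e2 : n + 1 - r = (n - r) + 1 := by omega
    rw [e1, e2, Q_succ]
    have h3 : (1 - (1/2:ℝ)^(n-r+1)) ≠ 0 := by linarith [half_pow_lt (n-r)]
    have h4 := Q_ne (n-r)
    have : (1 - (1/2:ℝ)^(n-r+1)) / (Q (n-r) * (1 - (1/2:ℝ)^(n-r+1))) = 1 / Q (n-r) := by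
      field_simp
    rw [this]
    linear_combination (1 / Q (n-r)) * aa_succ r
  rcases mul_eq_zero.1 key with h | h
  · linarith
  · exact h

lemma Kn_deriv (n : ℕ) (s : ℝ) : HasDerivAt (fun s => Real.exp s * Kn (n+1) s)
    (Real.exp s * (2 * Kn n (2*s))) s := by
  have h1 : HasDerivAt (Kn (n+1)) (∑ r ∈ Finset.range (n+1+1),
      aa r / Q (n+1-r) * (Real.exp (-2^r * s) * (-2^r * 1))) s := by
    unfold Kn
    apply HasDerivAt.fun_sum
    intro r _
    exact (((hasDerivAt_id' s).const_mul (-2^r)).exp).const_mul _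
  have h2 := (Real.hasDerivAt_exp s).mul h1
  refine HasDerivAt.congr_deriv h2 ?_
  symm
  rw [← mul_add]
  congr 1
  unfold Kn
  rw [← Finset.sum_add_distrib, Finset.sum_range_succ' (n := n+1), Finset.mul_sum]
  simp only [pow_zero]
  rw [show ∀ a b c : ℝ, a + (b * c + b * (c * (-1*1))) = a by intros; ring]
  apply Finset.sum_congr rfl
  intro r hr
  have e1 : n + 1 - (r+1) = n - r := by omega
  have e2 : (-2^(r+1) * s : ℝ) = -2^r * (2*s) := by ring
  rw [e1, e2]
  linear_combination (-1 / Q (n-r) * Real.exp (-2^r * (2*s))) * aa_succ' r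

lemma Kn_nonneg (n : ℕ) : ∀ s, 0 ≤ s → 0 ≤ Kn n s := by
  induction n with
  | zero => intro s hs; simp [Kn, aa_zero, Q_zero]; positivity
  | succ n ih =>
    intro s hs
    have hm : MonotoneOn (fun s => Real.exp s * Kn (n+1) s) (Set.Ici 0) := by
      apply monotoneOn_of_deriv_nonneg (convex_Ici 0)
      · exact fun x _ => (Kn_deriv n x).continuousAt.continuousWithinAt
      · exact fun x _ => (Kn_deriv n x).differentiableAt.differentiableWithinAt
      · intro x hx
        rw [interior_Ici] at hx
        rw [(Kn_deriv n x).deriv]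
        have := ih (2*x) (by have : 0 < x := hx; linarith)
        positivity
    have := hm (Set.mem_Ici.2 le_rfl) (Set.mem_Ici.2 hs) hs
    simp only [Kn_zero, mul_zero] at this
    exact nonneg_of_mul_nonneg_right this (Real.exp_pos s)

lemma exp_le_one' (r : ℕ) {s : ℝ} (hs : 0 ≤ s) : Real.exp (-2^r * s) ≤ 1 := by
  rw [Real.exp_le_one_iff]
  have : (0:ℝ) < 2^r := by positivity
  nlinarith

lemma termbound (r : ℕ) {s q : ℝ} (hq : 1/4 ≤ q) (hs : 0 ≤ s) :
    ‖aa r / q * Real.exp (-2^r * s)‖ ≤ 1024 * (1/2)^r := by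
  rw [norm_mul, Real.norm_of_nonneg (Real.exp_pos _).le, norm_div, Real.norm_of_nonneg (by linarith : 0 ≤ q),
    Real.norm_eq_abs]
  have h1 : |aa r| / q ≤ 1024 * (1/2)^r := by
    rw [div_le_iff₀ (by linarith)]
    have := abs_aa r
    have h2 : 0 < (1/2:ℝ)^r := by positivity
    nlinarith
  calc _ ≤ |aa r| / q * 1 := mul_le_mul_of_nonneg_left (exp_le_one' r hs) (div_nonneg (abs_nonneg _) (by linarith))
    _ ≤ _ := by simpa using h1

lemma K_nonneg {s : ℝ} (hs : 0 ≤ s) : 0 ≤ K s := by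
  have ht : Tendsto (fun n => ∑' r : ℕ, if r ∈ Finset.range (n+1) then aa r / Q (n-r) * Real.exp (-2^r * s) else 0)
      atTop (nhds (K s)) := by
    apply tendsto_tsum_of_dominated_convergence (sgeo 1024)
    · intro r
      have h1 : Tendsto (fun n => aa r / Q (n-r) * Real.exp (-2^r * s)) atTop
          (nhds (aa r / Qinf * Real.exp (-2^r * s))) := by
        refine Tendsto.mul_const _ (Tendsto.div tendsto_const_nhds ?_ Qinf_pos.ne')
        exact Q_tendsto.comp (tendsto_sub_atTop_nat r)
      refine h1.congr' ?_
      filter_upwards [eventually_ge_atTop r] with n hn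
      rw [if_pos (by simp; omega)]
    · refine Eventually.of_forall (fun n r => ?_)
      split_ifs
      · exact termbound r (Q_ge _) hs
      · simp
  refine ge_of_tendsto' ht (fun n => ?_)
  rw [tsum_eq_sum (s := Finset.range (n+1)) (by intro b hb; rw [if_neg hb]), 
    Finset.sum_congr rfl (g := fun r => aa r / Q (n-r) * Real.exp (-2^r * s)) (by intro b hb; rw [if_pos hb])]
  exact Kn_nonneg n s hs

lemma K_summable {s : ℝ} (hs : 0 ≤ s) : Summable (fun r : ℕ => aa r / Qinf * Real.exp (-2^r * s)) :=
  Summable.of_norm_bounded (sgeo 1024) (fun r => termbound r Qinf_ge hs)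

lemma K_le {s : ℝ} (hs : 0 ≤ s) : K s ≤ 2048 := by
  have h := Summable.tsum_le_tsum (fun r => le_trans (le_abs_self _) (termbound r Qinf_ge hs)) (K_summable hs) (sgeo 1024)
  have h2 : ∑' r : ℕ, 1024 * (1/2:ℝ)^r = 2048 := by
    rw [tsum_mul_left, tsum_geometric_two]; norm_num
  rw [h2] at h
  exact h

lemma K_contOn : ContinuousOn K (Set.Ici 0) := by
  unfold K
  apply continuousOn_tsum (u := fun r : ℕ => 1024 * (1/2:ℝ)^r)
  · intro r; fun_prop
  · exact sgeo 1024
  · intro r s hs; exact termbound r Qinf_ge hs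

lemma K_deriv {s : ℝ} (hs : 0 < s) : HasDerivAt K (2 * K (2*s) - K s) s := by
  have h := hasDerivAt_tsum_of_isPreconnected (t := Set.Ioi (0:ℝ)) (u := fun r : ℕ => 1024 * (1/2:ℝ)^r)
    (g := fun (r:ℕ) s => aa r / Qinf * Real.exp (-2^r * s))
    (g' := fun (r:ℕ) s => aa r / Qinf * (Real.exp (-2^r * s) * (-2^r * 1))) (sgeo 1024) isOpen_Ioi
    (convex_Ioi 0).isPreconnected
    (fun r y _ => (((hasDerivAt_id' y).const_mul (-2^r)).exp).const_mul _)
    (fun r y hy => by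
      rw [norm_mul, norm_mul, norm_div, Real.norm_of_nonneg (Real.exp_pos _).le, Real.norm_of_nonneg Qinf_pos.le,
        Real.norm_eq_abs, mul_one, norm_neg, Real.norm_of_nonneg (by positivity)]
      have h0 := Qinf_pos
      have h1 : |aa r| / Qinf * 2^r ≤ 1024 * (1/2)^r := by
        rw [div_mul_eq_mul_div, div_le_iff₀ Qinf_pos]
        have := abs_aa2 r
        have h2 : 0 < (1/2:ℝ)^r := by positivity
        nlinarith [Qinf_ge]
      refine le_trans ?_ h1
      refine mul_le_mul_of_nonneg_left ?_ (by positivity)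
      exact mul_le_of_le_one_left (by positivity) (exp_le_one' r (le_of_lt hy)))
    (Set.mem_Ioi.2 hs) (K_summable hs.le) (Set.mem_Ioi.2 hs)
  refine HasDerivAt.congr_deriv h ?_
  have hs1 := K_summable hs.le
  have hs2 := K_summable (s := 2*s) (by linarith)
  have hs3 : Summable (fun r : ℕ => aa r / Qinf * (Real.exp (-2^r * s) * (-2^r * 1)) + aa r / Qinf * Real.exp (-2^r * s)) := by
    rw [← summable_nat_add_iff 1]
    refine (hs2.mul_left 2).congr (fun r => ?_)
    have e2 : (-2^(r+1) * s : ℝ) = -2^r * (2*s) := by ring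
    rw [e2]
    linear_combination (-1 / Qinf * Real.exp (-2^r * (2*s))) * aa_succ' r
  have hs4 : Summable (fun r : ℕ => aa r / Qinf * (Real.exp (-2^r * s) * (-2^r * 1))) := by
    refine (hs3.sub hs1).congr (fun r => by ring)
  have : (∑' r : ℕ, aa r / Qinf * (Real.exp (-2^r * s) * (-2^r * 1))) + K s = 2 * K (2*s) := by
    unfold K
    rw [← hs4.tsum_add hs1, hs3.tsum_eq_zero_add, ← tsum_mul_left]
    simp only [pow_zero]
    rw [show ∀ a b c : ℝ, (b * (c * (-1*1)) + b * c) + a = a by intros; ring]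
    refine tsum_congr (fun r => ?_)
    have e2 : (-2^(r+1) * s : ℝ) = -2^r * (2*s) := by ring
    rw [e2]
    linear_combination (1 / Qinf * Real.exp (-2^r * (2*s))) * aa_succ' r
  linarith

lemma K_large {s : ℝ} (hs : 1024 < s) : 0 < K s := by
  have h0 : (0:ℝ) ≤ s := by linarith
  have hs1 := K_summable h0
  have h0' := Qinf_pos
  have hq1 : Qinf ≤ 1 := by
    refine le_of_tendsto' Q_tendsto (fun n => ?_)
    induction n with
    | zero => rw [Q_zero]
    | succ n ih =>
      rw [Q_succ]
      have : 0 < (1/2:ℝ)^(n+1) := by positivity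
      nlinarith [Q_pos n]
  have hE : Real.exp (-s) * (1 + s) ≤ 1 := by
    have h1 := Real.add_one_le_exp s
    have : Real.exp (-s) * Real.exp s = 1 := by rw [← Real.exp_add]; simp
    nlinarith [Real.exp_pos (-s)]
  have hb : ∀ r : ℕ, -(Real.exp (-s) * Real.exp (-s) * (512 * (1/2:ℝ)^r)) ≤ aa (r+1) / Qinf * Real.exp (-2^(r+1) * s) := by
    intro r
    have h1 : |aa (r+1)| / Qinf ≤ 512 * (1/2)^r := by
      rw [div_le_iff₀ Qinf_pos]
      have := abs_aa (r+1)
      have h2 : 0 < (1/2:ℝ)^r := by positivity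
      rw [pow_succ] at this
      nlinarith [Qinf_ge]
    have h2 : Real.exp (-2^(r+1) * s) ≤ Real.exp (-s) * Real.exp (-s) := by
      rw [← Real.exp_add, Real.exp_le_exp]
      have : (1:ℝ) ≤ 2^r := one_le_pow₀ (by norm_num)
      rw [pow_succ]; nlinarith
    have h3 : |aa (r+1) / Qinf * Real.exp (-2^(r+1) * s)| ≤ Real.exp (-s) * Real.exp (-s) * (512 * (1/2:ℝ)^r) := by
      rw [abs_mul, abs_div, abs_of_pos Qinf_pos, Real.abs_exp, mul_comm]
      exact mul_le_mul h2 h1 (by positivity) (by positivity)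
    linarith [neg_abs_le (aa (r+1) / Qinf * Real.exp (-2^(r+1) * s))]
  have hsum := Summable.tsum_le_tsum hb (((sgeo 512).mul_left _).neg) ((summable_nat_add_iff 1).2 hs1)
  rw [tsum_neg, tsum_mul_left, tsum_mul_left, tsum_geometric_two] at hsum
  unfold K
  rw [hs1.tsum_eq_zero_add, aa_zero]
  simp only [pow_zero, neg_mul, one_mul] at hsum ⊢
  have h1 : 1 ≤ 1 / Qinf := by rw [le_div_iff₀ Qinf_pos]; linarith
  have h2 := Real.exp_pos (-s)
  have h3 : Real.exp (-s) ≤ 1 / Qinf * Real.exp (-s) := le_mul_of_one_le_left h2.le h1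
  nlinarith

lemma K_pos {s : ℝ} (hs : 0 < s) : 0 < K s := by
  by_contra hc
  have h0 : K s = 0 := le_antisymm (not_lt.1 hc) (K_nonneg hs.le)
  have step : ∀ s, 0 < s → K s = 0 → K (2*s) = 0 := by
    intro s hs h
    have hm : IsLocalMin K s := by
      filter_upwards [lt_mem_nhds hs] with y hy
      rw [h]; exact K_nonneg hy.le
    have := hm.hasDerivAt_eq_zero (K_deriv hs)
    linarith
  have all : ∀ n : ℕ, K (2^n * s) = 0 := by
    intro n
    induction n with
    | zero => simpa using h0
    | succ n ih =>
      rw [pow_succ', mul_assoc]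
      exact step _ (by positivity) ih
  obtain ⟨n, hn⟩ := pow_unbounded_of_one_lt (1024 / s) (by norm_num : (1:ℝ) < 2)
  rw [div_lt_iff₀ hs] at hn
  have := K_large hn
  rw [all n] at this
  exact lt_irrefl _ this

noncomputable def bb (j h : ℕ) : ℝ := aa h * 4^h / Q (j-h)

noncomputable def AA (j : ℕ) (t : ℝ) : ℝ := ∑ h ∈ Finset.range (j+1), bb j h * Real.exp (-2^h * t)

lemma AA_cont (j : ℕ) : Continuous (AA j) := by unfold AA; fun_prop

lemma AA_bound (j : ℕ) {t : ℝ} (ht : 0 ≤ t) : |AA j t| ≤ 2048 := by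
  have h2 : ∑' r : ℕ, 1024 * (1/2:ℝ)^r = 2048 := by
    rw [tsum_mul_left, tsum_geometric_two]; norm_num
  rw [← h2]
  unfold AA
  refine le_trans (Finset.abs_sum_le_sum_abs _ _) ?_
  refine le_trans (Finset.sum_le_sum (g := fun r : ℕ => 1024 * (1/2:ℝ)^r) ?_)
    ((sgeo 1024).sum_le_tsum _ (fun r _ => by positivity))
  intro h _
  rw [abs_mul, Real.abs_exp]
  have hb : |bb j h| ≤ 1024 * (1/2)^h := by
    unfold bb
    rw [abs_div, abs_mul, abs_of_pos (Q_pos _), abs_of_pos (by positivity : (0:ℝ) < 4^h), div_le_iff₀ (Q_pos _)]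
    have := abs_aa4 h
    have h2 : 0 < (1/2:ℝ)^h := by positivity
    nlinarith [Q_ge (j-h)]
  exact le_trans (mul_le_of_le_one_right (abs_nonneg _) (exp_le_one' h ht)) hb

lemma term_eq (j r h l : ℕ) (x : ℝ) :
    (-1:ℝ)^(r+h+l) *
      (2:ℝ)^(-(j:ℤ) - (r.choose 2 : ℤ) - (h.choose 2 : ℤ) - (l.choose 2 : ℤ)
        + 2*(h:ℤ) + 2*(l:ℤ)) *
      phi ((2:ℝ)^(r+j)) ((2:ℝ)^h + (2:ℝ)^l) x /
      (Qinf * Q r * Q h * Q (j-h) * Q l * Q (j-l)) =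
    ∫ t in (0:ℝ)..x, (1/2)^j * (aa r / Qinf * Real.exp (-2^r * (2^j * (x - t)))) *
      (t * ((bb j h * Real.exp (-2^h * t)) * (bb j l * Real.exp (-2^l * t)))) := by
  have hz : (2:ℝ)^(-(j:ℤ) - (r.choose 2 : ℤ) - (h.choose 2 : ℤ) - (l.choose 2 : ℤ)
        + 2*(h:ℤ) + 2*(l:ℤ)) = (1/2)^j * (1/2)^(r.choose 2) * (1/2)^(h.choose 2) * (1/2)^(l.choose 2)
        * 4^h * 4^l := by
    have h2 : (2:ℝ) ≠ 0 := by norm_num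
    rw [zpow_add₀ h2, zpow_add₀ h2, zpow_sub₀ h2, zpow_sub₀ h2, zpow_sub₀ h2, zpow_neg, zpow_mul, zpow_mul]
    simp only [zpow_natCast, div_eq_mul_inv]
    norm_num
    simp only [one_div, inv_pow]
  rw [hz]
  unfold phi bb aa
  rw [← intervalIntegral.integral_const_mul, mul_div_right_comm, ← intervalIntegral.integral_const_mul]
  refine intervalIntegral.integral_congr (fun t _ => ?_)
  have he : Real.exp (-2^(r+j) * x) * Real.exp ((2^(r+j) - (2^h+2^l)) * t) =
      Real.exp (-2^r * (2^j * (x - t))) * Real.exp (-2^h * t) * Real.exp (-2^l * t) := by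
    rw [← Real.exp_add, ← Real.exp_add, ← Real.exp_add]
    congr 1
    ring
  beta_reduce
  rw [mul_left_comm (Real.exp (-2^(r+j) * x)), he]
  generalize Real.exp (-2^r * (2^j * (x - t))) = E1
  generalize Real.exp (-2^h * t) = E2
  generalize Real.exp (-2^l * t) = E3
  rw [pow_add, pow_add]
  have := Q_ne r
  have := Q_ne h
  have := Q_ne l
  have := Q_ne (j-h)
  have := Q_ne (j-l)
  have := Qinf_pos.ne'
  field_simp

lemma hl_sum_eq (j r : ℕ) (x : ℝ) :
    (∑ h ∈ Finset.range (j+1), ∑ l ∈ Finset.range (j+1),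
    (-1:ℝ)^(r+h+l) *
      (2:ℝ)^(-(j:ℤ) - (r.choose 2 : ℤ) - (h.choose 2 : ℤ) - (l.choose 2 : ℤ)
        + 2*(h:ℤ) + 2*(l:ℤ)) *
      phi ((2:ℝ)^(r+j)) ((2:ℝ)^h + (2:ℝ)^l) x /
      (Qinf * Q r * Q h * Q (j-h) * Q l * Q (j-l))) =
    ∫ t in (0:ℝ)..x, (1/2)^j * (aa r / Qinf * Real.exp (-2^r * (2^j * (x - t)))) * (t * (AA j t)^2) := by
  simp only [term_eq]
  have hc : ∀ h l : ℕ, Continuous (fun t : ℝ => (1/2)^j * (aa r / Qinf * Real.exp (-2^r * (2^j * (x - t)))) *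
      (t * ((bb j h * Real.exp (-2^h * t)) * (bb j l * Real.exp (-2^l * t))))) := by
    intro h l; fun_prop
  have e1 : ∀ h ∈ Finset.range (j+1), (∑ l ∈ Finset.range (j+1), ∫ t in (0:ℝ)..x, (1/2)^j * (aa r / Qinf * Real.exp (-2^r * (2^j * (x - t)))) *
      (t * ((bb j h * Real.exp (-2^h * t)) * (bb j l * Real.exp (-2^l * t))))) =
      ∫ t in (0:ℝ)..x, ∑ l ∈ Finset.range (j+1), (1/2)^j * (aa r / Qinf * Real.exp (-2^r * (2^j * (x - t)))) *
      (t * ((bb j h * Real.exp (-2^h * t)) * (bb j l * Real.exp (-2^l * t)))) := by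
    intro h _
    rw [intervalIntegral.integral_finsetSum]
    intro l _
    exact (hc h l).intervalIntegrable _ _
  rw [Finset.sum_congr rfl e1, ← intervalIntegral.integral_finsetSum]
  · refine intervalIntegral.integral_congr (fun t _ => ?_)
    beta_reduce
    rw [sq]
    unfold AA
    rw [Finset.sum_mul_sum, Finset.mul_sum, Finset.mul_sum]
    refine Finset.sum_congr rfl (fun h _ => ?_)
    rw [Finset.mul_sum, Finset.mul_sum]
  · intro h _
    exact (continuous_finsetSum _ (fun l _ => hc h l)).intervalIntegrable _ _

lemma r_sum (j : ℕ) {x : ℝ} (hx : 0 < x) :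
    (∑' r : ℕ, ∫ t in (0:ℝ)..x, (1/2)^j * (aa r / Qinf * Real.exp (-2^r * (2^j * (x - t)))) * (t * (AA j t)^2)) =
    ∫ t in (0:ℝ)..x, (1/2)^j * K (2^j * (x - t)) * (t * (AA j t)^2) := by
  have hAc := AA_cont j
  have key := intervalIntegral.hasSum_integral_of_dominated_convergence (a := 0) (b := x)
    (μ := MeasureTheory.volume)
    (F := fun (r:ℕ) t => (1/2)^j * (aa r / Qinf * Real.exp (-2^r * (2^j * (x - t)))) * (t * (AA j t)^2))
    (f := fun t => (1/2)^j * K (2^j * (x - t)) * (t * (AA j t)^2))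
    (fun r _ => (1/2:ℝ)^j * (1024 * (1/2:ℝ)^r) * (x * 2048^2)) ?_ ?_ ?_ ?_ ?_
  · exact key.tsum_eq
  · intro r
    apply Continuous.aestronglyMeasurable
    fun_prop
  · intro r
    refine MeasureTheory.ae_of_all _ (fun t ht => ?_)
    rw [Set.uIoc_of_le hx.le] at ht
    have h0 : (0:ℝ) ≤ 2^j * (x - t) := mul_nonneg (by positivity) (by linarith [ht.2])
    rw [norm_mul, norm_mul, norm_mul t, Real.norm_of_nonneg (by positivity), Real.norm_of_nonneg ht.1.le,
      norm_pow]
    have h1 := termbound r Qinf_ge h0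
    have h2 := AA_bound j ht.1.le
    have ht2 := ht.2
    have ht1 := ht.1.le
    rw [← Real.norm_eq_abs] at h2
    gcongr
  · refine MeasureTheory.ae_of_all _ (fun t _ => ?_)
    exact ((sgeo 1024).mul_left _).mul_right _
  · exact continuous_const.intervalIntegrable _ _
  · refine MeasureTheory.ae_of_all _ (fun t ht => ?_)
    rw [Set.uIoc_of_le hx.le] at ht
    have h0 : (0:ℝ) ≤ 2^j * (x - t) := mul_nonneg (by positivity) (by linarith [ht.2])
    exact ((K_summable h0).hasSum.mul_left _).mul_right _

lemma G_pos_aux : ∀ x : ℝ, 0 < x → 0 < G x := by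
  intro x hx
  unfold G
  simp only [hl_sum_eq]
  simp only [r_sum _ hx]
  have hcont : ∀ j : ℕ, ContinuousOn (fun t => (1/2)^j * K (2^j * (x - t)) * (t * (AA j t)^2)) (Set.Icc 0 x) := by
    intro j
    have h1 : ContinuousOn (fun t => K (2^j * (x - t))) (Set.Icc 0 x) := by
      refine K_contOn.comp (by fun_prop) ?_
      intro t ht
      have h0 : (0:ℝ) ≤ 2^j * (x - t) := mul_nonneg (by positivity) (by linarith [ht.2])
      exact h0
    have h2 := (AA_cont j).continuousOn (s := Set.Icc 0 x)
    fun_prop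
  have hint : ∀ j : ℕ, IntervalIntegrable (fun t => (1/2)^j * K (2^j * (x - t)) * (t * (AA j t)^2))
      MeasureTheory.volume 0 x := by
    intro j
    apply ContinuousOn.intervalIntegrable
    rw [Set.uIcc_of_le hx.le]
    exact hcont j
  have hnn : ∀ j : ℕ, 0 ≤ ∫ t in (0:ℝ)..x, (1/2)^j * K (2^j * (x - t)) * (t * (AA j t)^2) := by
    intro j
    refine intervalIntegral.integral_nonneg hx.le (fun t ht => ?_)
    have h0 : (0:ℝ) ≤ 2^j * (x - t) := mul_nonneg (by positivity) (by linarith [ht.2])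
    have := K_nonneg h0
    have := ht.1
    positivity
  refine Summable.tsum_pos ?_ hnn 0 ?_
  · refine Summable.of_nonneg_of_le hnn (fun j => ?_) (sgeo (2048 * (x * 2048^2) * x))
    have hle : ∀ t ∈ Set.Icc 0 x, (1/2)^j * K (2^j * (x - t)) * (t * (AA j t)^2) ≤
        (1/2)^j * 2048 * (x * 2048^2) := by
      intro t ht
      have h0 : (0:ℝ) ≤ 2^j * (x - t) := mul_nonneg (by positivity) (by linarith [ht.2])
      have h1 := K_nonneg h0
      have h2 := K_le h0
      have h3 := ht.1
      have h4 := ht.2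
      have h5 : (AA j t)^2 ≤ 2048^2 := by
        rw [← sq_abs (AA j t)]
        exact pow_le_pow_left₀ (abs_nonneg _) (AA_bound j h3) 2
      gcongr
    have := intervalIntegral.integral_mono_on hx.le (hint j) (continuous_const.intervalIntegrable 0 x) hle
    rw [intervalIntegral.integral_const] at this
    refine le_trans this (le_of_eq ?_)
    simp only [smul_eq_mul]
    ring
  · refine intervalIntegral.intervalIntegral_pos_of_pos_on (hint 0) (fun t ht => ?_) hx
    have h0 : (0:ℝ) < 2^0 * (x - t) := mul_pos (by positivity) (by linarith [ht.2])
    have h1 := K_pos h0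
    have h2 := ht.1
    have h3 : AA 0 t ≠ 0 := by
      simp [AA, bb, aa_zero, Q_zero]
    positivity

/-- `G(x) > 0` for every real `x > 0`. -/
theorem G_pos : ∀ x : ℝ, 0 < x → 0 < G x := by
  exact G_pos_aux
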